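/- arXiv:1906.11650 — 3 statements merged into one kernel-verified Lean document; each statement's English description precedes it below -/
import Mathlib

section
/- Let F be a field with at least 4 elements, v a valuation on F, and (qRP F)_v := qRP(F)/K_v. If x ∈ F^× has v(x) > 0 then [x] = C_F in (qRP F)_v, and if v(x) < 0 then [x] = −C_F in (qRP F)_v. -/
open scoped Classical

noncomputable section

variable (F : Type) [Field F]

/-- The group of square classes `G_F = F^× / (F^×)²`. -/
def SqCl (F : Type) [Field F] : Type :=
  Fˣ ⧸ (powMonoidHom 2 : Fˣ →* Fˣ).range

instance : CommGroup (SqCl F) := QuotientGroup.Quotient.commGroup _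

/-- The square class of a unit. -/
def sqc : Fˣ →* SqCl F := QuotientGroup.mk' _

/-- The group ring `R_F = ℤ[F^×/(F^×)²]`. -/
abbrev RF (F : Type) [Field F] : Type := MonoidAlgebra ℤ (SqCl F)

/-- `⟨x⟩ ∈ R_F`, the square class of a unit as an element of the group ring. -/
def cls (x : Fˣ) : RF F := MonoidAlgebra.of ℤ (SqCl F) (sqc F x)

/-- The free `R_F`-module on the set `F^×`. -/
abbrev FreeRP (F : Type) [Field F] : Type := Fˣ →₀ RF F

/-- The generator `[x]` of the free module. -/
def gen (x : Fˣ) : FreeRP F := Finsupp.single x 1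

/-- units from nonzero field elements -/
def U (x : F) (h : x ≠ 0) : Fˣ := Units.mk0 x h

variable {F}

theorem one_sub_ne {x : Fˣ} (hx : (x : F) ≠ 1) : (1 : F) - x ≠ 0 :=
  sub_ne_zero.mpr (Ne.symm hx)

theorem inv_sub_one_ne {x : Fˣ} (hx : (x : F) ≠ 1) : ((x : F)⁻¹ - 1) ≠ 0 :=
  sub_ne_zero.mpr (fun h => hx (by rwa [inv_eq_one] at h))

theorem one_sub_inv_ne {x : Fˣ} (hx : (x : F) ≠ 1) : (1 - (x : F)⁻¹) ≠ 0 :=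
  sub_ne_zero.mpr (fun h => hx (by rw [eq_comm, inv_eq_one] at h; exact h.symm ▸ rfl))

variable (F)

/-- The five term relation `S_{x,y}` as an element of the free module. -/
def FT (x y : Fˣ) (hx : (x : F) ≠ 1) (hy : (y : F) ≠ 1) : FreeRP F :=
  gen F x - gen F y + cls F x • gen F (y * x⁻¹)
    - cls F (U F ((x : F)⁻¹ - 1) (inv_sub_one_ne hx)) •
        gen F (U F ((1 - (x : F)⁻¹) / (1 - (y : F)⁻¹))
          (div_ne_zero (one_sub_inv_ne hx) (one_sub_inv_ne hy)))
    + cls F (U F (1 - (x : F)) (one_sub_ne hx)) •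
        gen F (U F ((1 - (x : F)) / (1 - (y : F)))
          (div_ne_zero (one_sub_ne hx) (one_sub_ne hy)))

/-- The set of five-term relations. -/
def ftRels : Set (FreeRP F) :=
  {w | ∃ (x y : Fˣ) (hx : (x : F) ≠ 1) (hy : (y : F) ≠ 1), w = FT F x y hx hy}

/-- The relations `ψ₁(x) = [x] + ⟨-1⟩[x⁻¹]`. -/
def psiRels : Set (FreeRP F) :=
  {w | ∃ x : Fˣ, w = gen F x + cls F (-1) • gen F x⁻¹}

/-- relations `⟨-1⟩[x] = [x]` -/
def minusRels : Set (FreeRP F) :=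
  {w | ∃ x : Fˣ, w = cls F (-1) • gen F x - gen F x}

/-- relations `[x⁻¹] = -[x]` -/
def invRels : Set (FreeRP F) :=
  {w | ∃ x : Fˣ, w = gen F x⁻¹ + gen F x}

/-- The module `qRP(F) = RP(F)/⟨ψ₁(x) : x ∈ F^×⟩`. -/
def qRP : Type := FreeRP F ⧸ Submodule.span (RF F) (ftRels F ∪ psiRels F)

instance : AddCommGroup (qRP F) := by unfold qRP; infer_instance
instance : Module (RF F) (qRP F) := by unfold qRP; infer_instance

/-- `[x] ∈ qRP(F)` -/
def qrp (x : Fˣ) : qRP F := Submodule.Quotient.mk (gen F x)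

/-- The module `RP′(F)`. -/
def RP' : Type :=
  FreeRP F ⧸ Submodule.span (RF F)
    ({gen F 1} ∪ ftRels F ∪ minusRels F ∪ invRels F)

instance : AddCommGroup (RP' F) := by unfold RP'; infer_instance
instance : Module (RF F) (RP' F) := by unfold RP'; infer_instance

/-- `[x] ∈ RP′(F)` -/
def rp (x : Fˣ) : RP' F := Submodule.Quotient.mk (gen F x)

/-- the submodule of `M` generated by the elements `(⟨a⟩ - χ(a))·m`. -/
def chiSub (χ : SqCl F →* ℤˣ) (M : Type) [AddCommGroup M] [Module (RF F) M] :
    Submodule (RF F) M :=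
  Submodule.span (RF F)
    {w | ∃ (a : Fˣ) (m : M), w = cls F a • m - ((χ (sqc F a) : ℤ)) • m}

/-- `M_χ` -/
def ChiQuot (χ : SqCl F →* ℤˣ) (M : Type) [AddCommGroup M] [Module (RF F) M] : Type :=
  M ⧸ chiSub F χ M

instance (χ : SqCl F →* ℤˣ) (M : Type) [AddCommGroup M] [Module (RF F) M] :
    AddCommGroup (ChiQuot F χ M) := by unfold ChiQuot; infer_instance
instance (χ : SqCl F →* ℤˣ) (M : Type) [AddCommGroup M] [Module (RF F) M] :
    Module (RF F) (ChiQuot F χ M) := by unfold ChiQuot; infer_instance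

/-- image of `m` in `M_χ` -/
def mkChi (χ : SqCl F →* ℤˣ) {M : Type} [AddCommGroup M] [Module (RF F) M] (m : M) :
    ChiQuot F χ M := Submodule.Quotient.mk m

/-- `M[1/2]`, as an `R_F`-module (localization at the powers of `2`). -/
def Loc2 (M : Type) [AddCommGroup M] [Module (RF F) M] : Type :=
  LocalizedModule (Submonoid.powers (2 : RF F)) M

instance (M : Type) [AddCommGroup M] [Module (RF F) M] : AddCommGroup (Loc2 F M) := by
  unfold Loc2; infer_instance
instance (M : Type) [AddCommGroup M] [Module (RF F) M] : Module (RF F) (Loc2 F M) := by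
  unfold Loc2; infer_instance

/-- the canonical map `M → M[1/2]` -/
def toLoc2 {M : Type} [AddCommGroup M] [Module (RF F) M] (m : M) : Loc2 F M :=
  LocalizedModule.mkLinearMap (Submonoid.powers (2 : RF F)) M m


/-- the square class of a field element (junk value `1` at `0`). -/
def sqv (a : F) : SqCl F := if h : a ≠ 0 then sqc F (U F a h) else 1

/-- `[a] ∈ RP′(F)` for a field element `a`, where `[0]` is assigned the value `c₀`. -/
def rpc (c₀ : RP' F) (a : F) : RP' F := if h : a ≠ 0 then rp F (U F a h) else c₀


section AdHocValuation

variable (F : Type) [Field F] (Γ : Type) [AddCommGroup Γ] [LinearOrder Γ] [IsOrderedAddMonoid Γ]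

/-- `1 + M_v ⊆ F^×`: the units congruent to `1` modulo the maximal ideal of
the valuation `v`. -/
def U1Set (v : Fˣ → Γ) : Set Fˣ :=
  {u : Fˣ | (u : F) = 1 ∨ ∃ h : (u : F) - 1 ≠ 0, 0 < v (U F ((u : F) - 1) h)}

/-- `K_v ⊆ qRP(F)`: the `R_F`-submodule generated by the `[u]` with `u ∈ 1 + M_v`. -/
def Kv (v : Fˣ → Γ) : Submodule (RF F) (qRP F) :=
  Submodule.span (RF F) (qrp F '' U1Set F Γ v)

/-- `v` is a valuation:  it is a homomorphism `F^× → Γ`, it is surjective, and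
it satisfies `v(x+y) ≥ min (v x) (v y)`. -/
def IsValuation (v : Fˣ → Γ) : Prop :=
  (∀ x y : Fˣ, v (x * y) = v x + v y) ∧ Function.Surjective v ∧
    ∀ (x y : Fˣ) (h : (x : F) + (y : F) ≠ 0),
      min (v x) (v y) ≤ v (U F ((x : F) + (y : F)) h)

end AdHocValuation
end

/-- Let `F` be a field with at least 4 elements, `v` a valuation on `F`
(with values in a totally ordered abelian group `Γ`), and `(qRP F)_v := qRP(F)/K_v`.
If `x ∈ F^×` has `v(x) > 0` then `[x] = C_F` in `(qRP F)_v`, and if `v(x) < 0` then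
`[x] = -C_F` in `(qRP F)_v`.  Here `C_F` is the common value of `[x] + ⟨-1⟩[1-x]`
over `x ∈ F^× \ {1}`. -/
theorem statement6 (F : Type) [Field F] (hcard : 4 ≤ Cardinal.mk F)
    (Γ : Type) [AddCommGroup Γ] [LinearOrder Γ] [IsOrderedAddMonoid Γ] (v : Fˣ → Γ) (hv : IsValuation F Γ v)
    (c : qRP F)
    (hc : ∀ (x : Fˣ) (hx : (x : F) ≠ 1),
      c = qrp F x + cls F (-1) • qrp F (U F (1 - (x : F)) (one_sub_ne hx)))
    (x : Fˣ) :
    (0 < v x →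
      (Submodule.Quotient.mk (qrp F x) : qRP F ⧸ Kv F Γ v) = Submodule.Quotient.mk c) ∧
    (v x < 0 →
      (Submodule.Quotient.mk (qrp F x) : qRP F ⧸ Kv F Γ v) =
        -Submodule.Quotient.mk c) := by
  obtain ⟨hmul, -, -⟩ := hv
  have h1 : v 1 = 0 := by
    have := hmul 1 1
    simpa using this
  have hneg1 : v (-1) = 0 := by
    have h := hmul (-1) (-1)
    rw [neg_mul_neg, one_mul, h1] at h
    rcases lt_trichotomy (v (-1)) 0 with h' | h' | h'
    · have := add_neg h' h'
      rw [← h] at this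
      exact absurd this (lt_irrefl _)
    · exact h'
    · have := add_pos h' h'
      rw [← h] at this
      exact absurd this (lt_irrefl _)
  have hsq : cls F (-1) * cls F (-1) = 1 := by
    unfold cls
    rw [← map_mul, ← map_mul, neg_mul_neg, one_mul, map_one, map_one]
  have hne : ∀ y : Fˣ, v y ≠ 0 → (y : F) ≠ 1 := by
    intro y hy h
    apply hy
    rw [Units.val_eq_one.mp h, h1]
  have hpsi : ∀ y : Fˣ, qrp F y + cls F (-1) • qrp F y⁻¹ = 0 := by
    intro y
    have : (gen F y + cls F (-1) • gen F y⁻¹) ∈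
        Submodule.span (RF F) (ftRels F ∪ psiRels F) :=
      Submodule.subset_span (Or.inr ⟨y, rfl⟩)
    exact (Submodule.Quotient.mk_eq_zero _).mpr this
  have hpos : ∀ y : Fˣ, 0 < v y →
      (Submodule.Quotient.mk (qrp F y) : qRP F ⧸ Kv F Γ v) = Submodule.Quotient.mk c := by
    intro y hy
    have hy1 := hne y hy.ne'
    have hmem : qrp F (U F (1 - (y : F)) (one_sub_ne hy1)) ∈ Kv F Γ v := by
      apply Submodule.subset_span
      refine ⟨_, Or.inr ?_, rfl⟩
      have e : ((U F (1 - (y : F)) (one_sub_ne hy1) : Fˣ) : F) - 1 = ((-1 * y : Fˣ) : F) := by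
        simp [U]
      refine ⟨by rw [e]; exact Units.ne_zero _, ?_⟩
      have e2 : ∀ h, U F (((U F (1 - (y : F)) (one_sub_ne hy1) : Fˣ) : F) - 1) h = -1 * y :=
        fun h => Units.ext e
      rw [e2, hmul, hneg1, zero_add]
      exact hy
    rw [hc y hy1, Submodule.Quotient.mk_add, Submodule.Quotient.mk_smul,
      (Submodule.Quotient.mk_eq_zero _).mpr hmem, smul_zero, add_zero]
  refine ⟨hpos x, fun hx => ?_⟩
  have hinv : 0 < v x⁻¹ := by
    have h := hmul x x⁻¹
    rw [mul_inv_cancel, h1] at h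
    rw [eq_neg_of_add_eq_zero_right h.symm]
    exact neg_pos.mpr hx
  have hcc : cls F (-1) • c = c := by
    have hx1 := hne x hx.ne
    have hx2 : ((U F (1 - (x : F)) (one_sub_ne hx1) : Fˣ) : F) ≠ 1 := by
      simp [U]
    have h2 := hc _ hx2
    have e : U F (1 - ((U F (1 - (x : F)) (one_sub_ne hx1) : Fˣ) : F)) (one_sub_ne hx2) = x :=
      Units.ext (by simp [U])
    rw [e] at h2
    conv_lhs => rw [hc x hx1]
    rw [smul_add, smul_smul, hsq, one_smul, add_comm]
    exact h2.symm
  rw [eq_neg_of_add_eq_zero_left (hpsi x), Submodule.Quotient.mk_neg, Submodule.Quotient.mk_smul,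
    hpos _ hinv, ← Submodule.Quotient.mk_smul, hcc]
end

section
/- Let F be a field with at least 4 elements, v a valuation on F, and (qRP F)_v := qRP(F)/K_v. Then [x] = [xu] in (qRP F)_v for all x ∈ F^× and all u ∈ 1 + M_v. -/
open scoped Classical

theorem qrp_FT (F : Type) [Field F] (x y : Fˣ) (hx : (x : F) ≠ 1) (hy : (y : F) ≠ 1) :
    qrp F x - qrp F y + cls F x • qrp F (y * x⁻¹)
    - cls F (U F ((x : F)⁻¹ - 1) (inv_sub_one_ne hx)) •
        qrp F (U F ((1 - (x : F)⁻¹) / (1 - (y : F)⁻¹))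
          (div_ne_zero (one_sub_inv_ne hx) (one_sub_inv_ne hy)))
    + cls F (U F (1 - (x : F)) (one_sub_ne hx)) •
        qrp F (U F ((1 - (x : F)) / (1 - (y : F)))
          (div_ne_zero (one_sub_ne hx) (one_sub_ne hy))) = 0 := by
  have h : (Submodule.Quotient.mk (FT F x y hx hy) :
      FreeRP F ⧸ Submodule.span (RF F) (ftRels F ∪ psiRels F)) = 0 := by
    rw [Submodule.Quotient.mk_eq_zero]
    exact Submodule.subset_span (Or.inl ⟨x, y, hx, hy, rfl⟩)
  exact h

section val
variable {F : Type} [Field F] {Γ : Type} [AddCommGroup Γ] [LinearOrder Γ] [IsOrderedAddMonoid Γ]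

/-- membership in the maximal ideal -/
def InM (v : Fˣ → Γ) (a : F) : Prop := a = 0 ∨ ∃ h : a ≠ 0, 0 < v (U F a h)

theorem InM.add {v : Fˣ → Γ} (hv : IsValuation F Γ v) {a b : F} (ha : InM v a) (hb : InM v b) :
    InM v (a + b) := by
  rcases ha with rfl | ⟨ha, ha'⟩
  · simpa using hb
  rcases hb with rfl | ⟨hb, hb'⟩
  · rw [add_zero]; exact Or.inr ⟨ha, ha'⟩
  by_cases h : a + b = 0
  · exact Or.inl h
  · exact Or.inr ⟨h, lt_of_lt_of_le (lt_min ha' hb') (hv.2.2 (U F a ha) (U F b hb) h)⟩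

theorem InM.mul {v : Fˣ → Γ} (hv : IsValuation F Γ v) {a : F} (ha : InM v a) (c : Fˣ)
    (hc : 0 ≤ v c) : InM v (a * c) := by
  rcases ha with rfl | ⟨ha, ha'⟩
  · left; simp
  · refine Or.inr ⟨mul_ne_zero ha c.ne_zero, ?_⟩
    have : U F (a * c) (mul_ne_zero ha c.ne_zero) = U F a ha * c := by
      ext; simp [U]
    rw [this, hv.1]
    exact add_pos_of_pos_of_nonneg ha' hc

theorem v_one {v : Fˣ → Γ} (hv : IsValuation F Γ v) : v 1 = 0 := by
  have := hv.1 1 1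
  simpa using this

theorem v_inv {v : Fˣ → Γ} (hv : IsValuation F Γ v) (x : Fˣ) : v x⁻¹ = - v x := by
  have := hv.1 x x⁻¹
  rw [mul_inv_cancel, v_one hv] at this
  exact eq_neg_of_add_eq_zero_right this.symm

theorem v_neg_one {v : Fˣ → Γ} (hv : IsValuation F Γ v) : v (-1) = 0 := by
  have h := v_inv hv (-1)
  rw [inv_neg_one] at h
  exact self_eq_neg.mp h

theorem InM.neg {v : Fˣ → Γ} (hv : IsValuation F Γ v) {a : F} (ha : InM v a) : InM v (-a) := by
  simpa using ha.mul hv (-1) (v_neg_one hv).ge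

theorem not_InM_one {v : Fˣ → Γ} (hv : IsValuation F Γ v) : ¬ InM v (1 : F) := by
  rintro (h | ⟨h, h'⟩)
  · exact one_ne_zero h
  · have : U F 1 h = 1 := by ext; simp [U]
    rw [this, v_one hv] at h'
    exact lt_irrefl _ h'

theorem mem_U1 {v : Fˣ → Γ} {u : Fˣ} : u ∈ U1Set F Γ v ↔ InM v ((u : F) - 1) := by
  simp [U1Set, InM, sub_eq_zero]

theorem v_U1 {v : Fˣ → Γ} (hv : IsValuation F Γ v) {u : Fˣ} (hu : u ∈ U1Set F Γ v) : v u = 0 := by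
  have hu' := mem_U1.1 hu
  rcases lt_trichotomy (v u) 0 with h | h | h
  · exfalso
    rcases hu' with h0 | ⟨h0, h0'⟩
    · have : u = 1 := by ext; simpa [sub_eq_zero] using h0
      subst this
      simp [v_one hv] at h
    · have := hv.2.2 (U F ((u : F) - 1) h0) 1 (by simp [U])
      have e : U F (((U F ((u : F) - 1) h0 : Fˣ) : F) + ((1 : Fˣ) : F)) (by simp [U]) = u := by
        ext; simp [U]
      rw [e, v_one hv] at this
      exact absurd h (not_lt.2 (le_trans (le_min h0'.le le_rfl) this))
  · exact h
  · exfalso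
    have h1 : InM v (u : F) := Or.inr ⟨u.ne_zero, by simpa [U] using h⟩
    have := h1.add hv (hu'.neg hv)
    exact not_InM_one hv (by simpa using this)

theorem U1_mul {v : Fˣ → Γ} (hv : IsValuation F Γ v) {u w : Fˣ} (hu : u ∈ U1Set F Γ v)
    (hw : w ∈ U1Set F Γ v) : u * w ∈ U1Set F Γ v := by
  rw [mem_U1]
  have := ((mem_U1.1 hu).mul hv w (v_U1 hv hw).ge).add hv (mem_U1.1 hw)
  convert this using 1
  push_cast; ring

theorem U1_inv {v : Fˣ → Γ} (hv : IsValuation F Γ v) {u : Fˣ} (hu : u ∈ U1Set F Γ v) :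
    u⁻¹ ∈ U1Set F Γ v := by
  rw [mem_U1]
  have := ((mem_U1.1 hu).mul hv u⁻¹ (by rw [v_inv hv, v_U1 hv hu, neg_zero])).neg hv
  convert this using 1
  have := u.ne_zero
  push_cast; field_simp; ring

end val

theorem statement7 (F : Type) [Field F] (hcard : 4 ≤ Cardinal.mk F)
    (Γ : Type) [AddCommGroup Γ] [LinearOrder Γ] [IsOrderedAddMonoid Γ] (v : Fˣ → Γ) (hv : IsValuation F Γ v)
    (x u : Fˣ) (hu : u ∈ U1Set F Γ v) :
    (Submodule.Quotient.mk (qrp F x) : qRP F ⧸ Kv F Γ v) =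
      Submodule.Quotient.mk (qrp F (x * u)) := by
  have hK : ∀ w ∈ U1Set F Γ v, qrp F w ∈ Kv F Γ v := fun w hw =>
    Submodule.subset_span ⟨w, hw, rfl⟩
  rw [Submodule.Quotient.eq]
  by_cases hxU : x ∈ U1Set F Γ v
  · exact Submodule.sub_mem _ (hK _ hxU) (hK _ (U1_mul hv hxU hu))
  have hxi : x⁻¹ ∉ U1Set F Γ v := fun h => hxU (by simpa using U1_inv hv h)
  have hxu : x * u ∉ U1Set F Γ v := fun h => hxU (by simpa using U1_mul hv h (U1_inv hv hu))
  have hx1 : (x : F) ≠ 1 := fun h => hxU (Or.inl h)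
  have hxu1 : ((x * u : Fˣ) : F) ≠ 1 := fun h => hxu (Or.inl h)
  have hx0 := x.ne_zero
  have hu0 := u.ne_zero
  have d1 := one_sub_ne hx1
  have d2 := one_sub_ne hxu1
  have hd : (x : F)⁻¹ - 1 ≠ 0 := inv_sub_one_ne hx1
  have hvd : v (U F _ hd) ≤ 0 := by
    by_contra h
    apply hxi
    rw [mem_U1]
    exact Or.inr ⟨by simpa using hd, by simpa using h⟩
  have hw : (U F ((1 - (x : F)) / (1 - ((x * u : Fˣ) : F))) (div_ne_zero d1 d2)) ∈ U1Set F Γ v := by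
    have := U1_inv hv (u := (U F ((1 - ((x * u : Fˣ) : F)) / (1 - (x : F))) (div_ne_zero d2 d1))) ?_
    · convert this using 1
      ext; simp [U]
    · rw [mem_U1]
      have := ((mem_U1.1 hu).mul hv (U F _ hd)⁻¹ (by rw [v_inv hv]; exact neg_nonneg.2 hvd)).neg hv
      convert this using 1
      simp only [U, Units.val_mk0, Units.val_inv_eq_inv_val, Units.val_mul]
      have e : (x : F)⁻¹ - 1 = (1 - x) / x := by field_simp
      rw [e]
      field_simp
      ring
  have hw2 : (U F ((1 - (x : F)⁻¹) / (1 - ((x * u : Fˣ) : F)⁻¹))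
      (div_ne_zero (one_sub_inv_ne hx1) (one_sub_inv_ne hxu1))) ∈ U1Set F Γ v := by
    have := U1_mul hv hu hw
    convert this using 1
    ext
    have d3 := one_sub_inv_ne hxu1
    simp only [U, Units.val_mk0, Units.val_mul] at d2 d3 ⊢
    have e : 1 - (x * u : F)⁻¹ = - (1 - x * u) / (x * u) := by field_simp; ring
    rw [e]
    field_simp
    ring
  have h := qrp_FT F x (x * u) hx1 hxu1
  have e : x * u * x⁻¹ = u := by rw [mul_comm x u, mul_inv_cancel_right]
  rw [e] at h
  have h2 := Submodule.smul_mem (Kv F Γ v) (cls F x) (hK _ hu)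
  have h3 := Submodule.smul_mem (Kv F Γ v) (cls F (U F ((x : F)⁻¹ - 1) (inv_sub_one_ne hx1))) (hK _ hw2)
  have h4 := Submodule.smul_mem (Kv F Γ v) (cls F (U F (1 - (x : F)) (one_sub_ne hx1))) (hK _ hw)
  have h5 := Submodule.sub_mem _ (Submodule.sub_mem _ h3 h2) h4
  convert h5 using 1
  rw [← sub_eq_zero, ← h]
  abel
end

section
/- Let F be a field with at least 4 elements, v a valuation on F, and (qRP F)_v := qRP(F)/K_v. Then ⟨u⟩·[x] = [x] in (qRP F)_v for all x ∈ F^× and all u ∈ 1 + M_v. -/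
open scoped Classical

/-- Abstract data: a field with valuation ideal `P`, valuation ring `O`, a multiplicative
symbol `s` and a function `f` satisfying the relations. -/
structure VCtx (F R Q : Type) [Field F] [CommRing R] [AddCommGroup Q] [Module R Q]
    (P O : F → Prop) (s : F →*₀ R) (f : F → Q) : Prop where
  Padd : ∀ a b, P a → P b → P (a + b)
  Oadd : ∀ a b, O a → O b → O (a + b)
  Omul : ∀ a b, O a → O b → O (a * b)
  OP : ∀ a b, O a → P b → P (a * b)
  PO : ∀ a, P a → O a
  P0 : P 0
  O1 : O 1
  Om1 : O (-1)
  P1 : ¬ P 1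
  notP : ∀ a, ¬ P a → O a⁻¹
  notO : ∀ a, ¬ O a → P a⁻¹
  s2 : ∀ a, a ≠ 0 → s a * s a = 1
  psi : ∀ a, a ≠ 0 → f a + s (-1) • f a⁻¹ = 0
  fU : ∀ a, P (a - 1) → f a = 0
  ft : ∀ x y, x ≠ 0 → y ≠ 0 → x ≠ 1 → y ≠ 1 →
    f x - f y + s x • f (y * x⁻¹) - s (x⁻¹ - 1) • f ((1 - x⁻¹) / (1 - y⁻¹))
      + s (1 - x) • f ((1 - x) / (1 - y)) = 0

namespace VCtx

variable {F R Q : Type} [Field F] [CommRing R] [AddCommGroup Q] [Module R Q]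
    {P O : F → Prop} {s : F →*₀ R} {f : F → Q}

theorem Pneg (C : VCtx F R Q P O s f) {a : F} (h : P a) : P (-a) := by
  have := C.OP _ _ C.Om1 h
  simpa using this

theorem Oneg (C : VCtx F R Q P O s f) {a : F} (h : O a) : O (-a) := by
  have := C.Omul _ _ C.Om1 h
  simpa using this

theorem one_sub (C : VCtx F R Q P O s f) {a : F} (h : P a) : 1 - a ≠ 0 := by
  intro h0
  have : a = 1 := by linear_combination -h0
  exact C.P1 (this ▸ h)

theorem one_subP (C : VCtx F R Q P O s f) {a : F} (h : P a) : ¬ P (1 - a) := by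
  intro h0
  have := C.Padd _ _ h0 h
  simp only [sub_add_cancel] at this
  exact C.P1 this

theorem Une (C : VCtx F R Q P O s f) {u : F} (h : P (u - 1)) : u ≠ 0 := by
  rintro rfl
  have := C.Pneg h
  simp only [zero_sub, neg_neg] at this
  exact C.P1 this

theorem UO (C : VCtx F R Q P O s f) {u : F} (h : P (u - 1)) : O u := by
  have := C.Oadd _ _ (C.PO _ h) C.O1
  simpa using this

theorem Uinv (C : VCtx F R Q P O s f) {u : F} (h : P (u - 1)) : P (u⁻¹ - 1) := by
  have h0 := C.Une h
  have h1 : ¬ P u := fun hP => by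
    have := C.Padd _ _ hP (C.Pneg h)
    apply C.P1
    convert this using 1
    ring
  have := C.OP _ _ (C.notP _ h1) (C.Pneg h)
  convert this using 1
  field_simp
  ring

theorem Umul (C : VCtx F R Q P O s f) {u w : F} (h : P (u - 1)) (h' : P (w - 1)) :
    P (u * w - 1) := by
  have := C.Padd _ _ (C.OP _ _ (C.UO h) h') h
  convert this using 1
  ring

theorem U1m (C : VCtx F R Q P O s f) {a : F} (h : P a) : P ((1 - a) - 1) := by
  have := C.Pneg h
  convert this using 1
  ring

theorem sinv (C : VCtx F R Q P O s f) {a : F} (h : a ≠ 0) : s a⁻¹ = s a := by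
  have h1 : s a * s a⁻¹ = 1 := by rw [← map_mul, mul_inv_cancel₀ h, map_one]
  have h2 := C.s2 a h
  linear_combination s a * h1 - s a⁻¹ * h2

theorem ee (C : VCtx F R Q P O s f) : s (-1) * s (-1) = 1 := C.s2 _ (by simp)

theorem finv (C : VCtx F R Q P O s f) {a : F} (h : a ≠ 0) : f a⁻¹ = -(s (-1) • f a) := by
  have := C.psi a h
  have e := C.ee
  linear_combination (norm := module) s (-1) • this - e • f a⁻¹

/-- the five term relation in convenient form -/
theorem ft' (C : VCtx F R Q P O s f) {x y : F} (hx : x ≠ 0) (hy : y ≠ 0) (hx1 : 1 - x ≠ 0)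
    (hy1 : 1 - y ≠ 0) :
    f x - f y + s x • f (y * x⁻¹) - (s x * s (1 - x)) • f (((1 - x) / (1 - y)) * (y * x⁻¹))
      + s (1 - x) • f ((1 - x) / (1 - y)) = 0 := by
  have h1 : x ≠ 1 := fun h => hx1 (by rw [h, sub_self])
  have h2 : y ≠ 1 := fun h => hy1 (by rw [h, sub_self])
  have h := C.ft x y hx hy h1 h2
  have e1 : x⁻¹ - 1 = x⁻¹ * (1 - x) := by field_simp
  have e2 : (1 - x⁻¹) / (1 - y⁻¹) = ((1 - x) / (1 - y)) * (y * x⁻¹) := by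
    have : y - 1 ≠ 0 := sub_ne_zero.mpr h2
    have h3 : 1 - y⁻¹ = -(1 - y) * y⁻¹ := by field_simp; ring
    have h4 : 1 - x⁻¹ = -(1 - x) * x⁻¹ := by field_simp; ring
    rw [h3, h4]
    field_simp
  rw [e2, e1, map_mul, C.sinv hx] at h
  exact h

theorem fcong (C : VCtx F R Q P O s f) {x u : F} (hx : x ≠ 0) (hu : P (u - 1)) :
    f (x * u) = f x := by
  by_cases h : P (x - 1)
  · rw [C.fU _ h, C.fU _ (C.Umul h hu)]
  have h1 : ¬ P (1 - x) := fun h' => h (by simpa using C.Pneg h')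
  have h10 : 1 - x ≠ 0 := fun h' => h1 (h' ▸ C.P0)
  have hu0 := C.Une hu
  have hO : O (x * (1 - x)⁻¹) := by
    have := C.Oadd _ _ (C.notP _ h1) C.Om1
    convert this using 1
    field_simp
    ring
  have hq : P ((1 - x * u) / (1 - x) - 1) := by
    have := C.OP _ _ hO (C.Pneg hu)
    convert this using 1
    field_simp
    ring
  have hq0 := C.Une hq
  have h2 : 1 - x * u ≠ 0 := fun h' => hq0 (by rw [h', zero_div])
  have hq' : P ((1 - x) / (1 - x * u) - 1) := by
    have := C.Uinv hq
    rwa [inv_div] at this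
  have key := C.ft' hx (mul_ne_zero hx hu0) h10 h2
  have e1 : x * u * x⁻¹ = u := by field_simp
  rw [e1, C.fU _ hu, C.fU _ hq', C.fU _ (C.Umul hq' hu)] at key
  simp only [smul_zero, add_zero, sub_zero] at key
  exact (sub_eq_zero.mp key).symm

theorem fcong' (C : VCtx F R Q P O s f) {x y u : F} (hx : x ≠ 0) (hu : P (u - 1))
    (h : y = x * u) : f y = f x := by
  rw [h, C.fcong hx hu]

theorem lemB (C : VCtx F R Q P O s f) {x m : F} (hx : x ≠ 0) (hm : m ≠ 0) (hxP : P x)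
    (hmP : P m) : f m - s x • f (x * m) = s (1 - x) • (s (-1) - s x) • f x := by
  have t0 := C.one_sub hxP
  have m0 := C.one_sub hmP
  have h := C.ft' (y := 1 - m) hx m0 t0 (by simpa using hm)
  have hU := C.U1m hmP
  have hT := C.U1m hxP
  rw [C.fU _ hU, C.fcong' (x := x⁻¹) (u := 1 - m) (inv_ne_zero hx) hU (mul_comm _ _),
    C.fcong' (x := (x * m)⁻¹) (y := (1 - x) / (1 - (1 - m)) * ((1 - m) * x⁻¹)) (u := (1 - x) * (1 - m)) (by simp [hx, hm]) (C.Umul hT hU)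
      (by simp only [sub_sub_cancel]; field_simp),
    C.fcong' (x := m⁻¹) (u := (1 - x)) (y := (1 - x) / (1 - (1 - m))) (by simp [hm]) hT
      (by simp only [sub_sub_cancel]; field_simp), C.finv hx, C.finv hm,
      C.finv (mul_ne_zero hx hm)] at h
  have e := C.ee
  have t2 := C.s2 _ t0
  generalize s (1 - x) = t at *
  generalize s (-1) = ε at *
  generalize s x = a at *
  generalize f x = X at *
  generalize f m = M at *
  generalize f (x * m) = XM at *
  have te : ε * ε * (t * t) = 1 := by rw [e, t2, one_mul]
  linear_combination (norm := module) (-ε * t) • h - te • M + te • a • XM - e • (a * t) • X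

theorem lemC (C : VCtx F R Q P O s f) {m n w : F} (hm : m ≠ 0) (hn : n ≠ 0) (hmP : P m)
    (hnP : P n) (hw : P (w - 1)) : (1 - s w) • f m = (1 - s w) • f n := by
  have w0 := C.Une hw
  have hmw : P (m * w) := by
    rw [mul_comm]; exact C.OP _ _ (C.UO hw) hmP
  have h1 := C.lemB hm hm hmP hmP
  have h2 := C.lemB hm hn hmP hnP
  have h3 := C.lemB (mul_ne_zero hm w0) hm hmw hmP
  have h4 := C.lemB (mul_ne_zero hm w0) hn hmw hnP
  rw [← h1] at h2
  rw [← h3] at h4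
  rw [C.fcong' (x := m * m) (y := m * w * m) (mul_ne_zero hm hm) hw (by ring),
    C.fcong' (x := m * n) (y := m * w * n) (mul_ne_zero hm hn) hw (by ring), map_mul] at h4
  linear_combination (norm := module) s w • h2 - h4

theorem lemD (C : VCtx F R Q P O s f) {m x w : F} (hm : m ≠ 0) (hmP : P m) (hx : x ≠ 0)
    (hxP : P x) (hw : P (w - 1)) :
    (1 - s x) • (1 - s w) • f m = s (1 - x) • (s (-1) - s x) • (1 - s w) • f m := by
  have h := C.lemB hx hm hxP hmP
  have h1 := C.lemC (mul_ne_zero hx hm) hm (C.OP _ _ (C.PO _ hxP) hmP) hmP hw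
  have h2 := C.lemC hx hm hxP hmP hw
  linear_combination (norm := module) (1 - s w) • h + s x • h1 + (s (1 - x) * (s (-1) - s x)) • h2

theorem lemD1 (C : VCtx F R Q P O s f) {m w : F} (hm : m ≠ 0) (hmP : P m) (hw : P (w - 1)) :
    s (-1) • (1 - s w) • f m = (1 - s w) • f m := by
  have hP := C.OP _ _ (C.PO _ hmP) hmP
  have h := C.lemD hm hmP (mul_ne_zero hm hm) hP hw
  have t2 := C.s2 _ (C.one_sub hP)
  rw [map_mul s m m, C.s2 m hm] at h
  generalize s (1 - m * m) = t at *
  linear_combination (norm := module) (-t) • h - t2 • (s (-1) - 1) • (1 - s w) • f m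

theorem lemE (C : VCtx F R Q P O s f) {x n : F} (hx : x ≠ 0) (hn : n ≠ 0) (hxP : P x)
    (hnP : P n) : f x + s (-1) • f n - (s (-1) * s x) • f (n * x)
      + (s x * s (1 - x) * s (-1)) • f (-x) + s (1 - x) • f (-n) = 0 := by
  have t0 := C.one_sub hxP
  have m0 := C.one_sub hnP
  have m0' : n - 1 ≠ 0 := fun h => m0 (by linear_combination -h)
  have e0 : 1 - n⁻¹ = -(1 - n) * n⁻¹ := by field_simp; ring
  have m1 : 1 - n⁻¹ ≠ 0 := by
    rw [e0]; exact mul_ne_zero (neg_ne_zero.mpr m0) (inv_ne_zero hn)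
  have h := C.ft' (y := n⁻¹) hx (inv_ne_zero hn) t0 m1
  have hU := C.Uinv (C.U1m hnP)
  have hT := C.U1m hxP
  have e1 : n⁻¹ * x⁻¹ = (n * x)⁻¹ := by field_simp
  rw [C.fcong' (x := (-x)⁻¹) (y := (1 - x) / (1 - n⁻¹) * (n⁻¹ * x⁻¹))
      (u := (1 - x) * (1 - n)⁻¹) (by simp [hx]) (C.Umul hT hU)
      (by rw [e0]; field_simp),
    C.fcong' (x := -n) (y := (1 - x) / (1 - n⁻¹))
      (u := (1 - x) * (1 - n)⁻¹) (by simp [hn]) (C.Umul hT hU)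
      (by rw [e0]; field_simp), e1,
    C.finv (mul_ne_zero hn hx), C.finv hn, C.finv (neg_ne_zero.mpr hx)] at h
  linear_combination (norm := module) h

theorem lemE1 (C : VCtx F R Q P O s f) {m w : F} (hm : m ≠ 0) (hmP : P m) (hw : P (w - 1))
    (hw1 : w ≠ 1) : s w • f m = f m := by
  have hx : 1 - w ≠ 0 := fun h => hw1 (by linear_combination -h)
  have hxP : P (1 - w) := by simpa using C.Pneg hw
  have h := C.lemE hx hm hxP hmP
  have a1 := C.lemC hx hm hxP hmP hw
  have a2 := C.lemC (mul_ne_zero hm hx) hm (C.OP _ _ (C.PO _ hmP) hxP) hmP hw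
  have a3 := C.lemC (neg_ne_zero.mpr hx) hm (C.Pneg hxP) hmP hw
  have a4 := C.lemC (neg_ne_zero.mpr hm) hm (C.Pneg hmP) hmP hw
  have ed := C.lemD1 hm hmP hw
  have d := C.lemD hm hmP hx hxP hw
  have w2 := C.s2 w (C.Une hw)
  have sc : s w • (1 - s w) • f m = -((1 - s w) • f m) := by
    linear_combination (norm := module) (-w2) • f m
  rw [sub_sub_cancel] at h d
  generalize s (-1) = ε at *
  have hc : (1 - s w) • f m = 0 := by
    have k : (2 + s (1 - w) * (s w - 1) + s w) • (1 - s w) • f m = 0 := by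
      linear_combination (norm := module) (1 - s w) • h - a1 - ε • (a4 - a4) + (ε * s (1 - w)) • a2
        - (s (1 - w) * s w * ε) • a3 - s w • a4 - ed + s (1 - w) • ed - (s (1 - w) * s w) • ed
    generalize (1 - s w) • f m = c at *
    have sc' : s w • s (1 - w) • c = - s (1 - w) • c := by
      linear_combination (norm := module) s (1 - w) • sc
    have k1 : c = (2 : R) • s (1 - w) • c := by
      linear_combination (norm := module) k - sc' - sc
    have d1 : (2 : R) • c = (2 : R) • s (1 - w) • c := by
      linear_combination (norm := module) d + s w • ed + sc - sc'
    linear_combination (norm := module) d1 - k1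
  linear_combination (norm := module) -hc

theorem lemF (C : VCtx F R Q P O s f) (hU : ∀ m, m ≠ 0 → P m → ∀ w, P (w - 1) → s w • f m = f m)
    {x m : F} (hx : x ≠ 0) (hxP : P x) (hm : m ≠ 0) (hmP : P m) :
    f m - s x • f (x * m) = (s (-1) - s x) • f x := by
  have h := C.lemB hx hm hxP hmP
  have := hU x hx hxP _ (C.U1m hxP)
  linear_combination (norm := module) h + (s (-1) - s x) • this

theorem lemF1 (C : VCtx F R Q P O s f) (hU : ∀ m, m ≠ 0 → P m → ∀ w, P (w - 1) → s w • f m = f m)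
    {x : F} (hx : x ≠ 0) (hxP : P x) : s (-1) • f x = f x := by
  have hx2 := mul_ne_zero hx hx
  have hP2 := C.OP _ _ (C.PO _ hxP) hxP
  have h1 := C.lemF hU hx hxP hx hxP
  have h2 := C.lemF hU hx hxP hx2 hP2
  have h3 := C.lemF hU hx2 hP2 hx hxP
  have e := C.ee
  have a2 := C.s2 x hx
  rw [map_mul, a2, mul_assoc] at h3
  generalize s (-1) = ε at *
  generalize s x = a at *
  generalize f (x * (x * x)) = X3 at *
  generalize f (x * x) = X2 at *
  generalize f x = X at *
  have hB : X2 = (a - ε * a + 1) • X := by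
    linear_combination (norm := module) (-a) • h1 - a2 • X2 + a2 • X
  have hB2 : a • X2 = (1 - ε + a) • X := by
    linear_combination (norm := module) - h1
  have h4 : X2 + (ε - 1) • a • X2 = ε • X := by
    linear_combination (norm := module) h2 - a • h3
  rw [hB2, hB] at h4
  linear_combination (norm := module) h4 + e • X

theorem lemG (C : VCtx F R Q P O s f) (hU : ∀ m, m ≠ 0 → P m → ∀ w, P (w - 1) → s w • f m = f m)
    {x n : F} (hx : x ≠ 0) (hxP : P x) (hn : n ≠ 0) (hnP : P n) :
    (2 - s x) • f x + s x • f (-x) + f (-n) = 0 := by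
  have h := C.lemE hx hn hxP hnP
  have f1 := C.lemF hU hx hxP hn hnP
  have ex := C.lemF1 hU hx hxP
  have en := C.lemF1 hU hn hnP
  have enx := C.lemF1 hU (mul_ne_zero hn hx) (C.OP _ _ (C.PO _ hnP) hxP)
  have emx := C.lemF1 hU (neg_ne_zero.mpr hx) (C.Pneg hxP)
  have u1 := hU _ (neg_ne_zero.mpr hx) (C.Pneg hxP) _ (C.U1m hxP)
  have u2 := hU _ (neg_ne_zero.mpr hn) (C.Pneg hnP) _ (C.U1m hxP)
  rw [mul_comm x n] at f1
  linear_combination (norm := module) h - f1 - ex - en + s x • enx - u2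
    - (s x * s (-1)) • u1 - s x • emx

theorem lemG1 (C : VCtx F R Q P O s f) (hU : ∀ m, m ≠ 0 → P m → ∀ w, P (w - 1) → s w • f m = f m)
    {x n : F} (hx : x ≠ 0) (hxP : P x) (hn : n ≠ 0) (hnP : P n) : f x = f n := by
  have h1 := C.lemG hU hx hxP (neg_ne_zero.mpr hx) (C.Pneg hxP)
  have h2 := C.lemG hU hx hxP (neg_ne_zero.mpr hn) (C.Pneg hnP)
  rw [neg_neg] at h1 h2
  linear_combination (norm := module) h1 - h2

theorem lemG2 (C : VCtx F R Q P O s f) (hU : ∀ m, m ≠ 0 → P m → ∀ w, P (w - 1) → s w • f m = f m)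
    {x : F} (hx : x ≠ 0) (hxP : P x) : (3 : R) • f x = 0 := by
  have h1 := C.lemG hU hx hxP hx hxP
  have h2 := C.lemG1 hU (neg_ne_zero.mpr hx) (C.Pneg hxP) hx hxP
  rw [h2] at h1
  linear_combination (norm := module) h1

theorem lemH (C : VCtx F R Q P O s f) (hU : ∀ m, m ≠ 0 → P m → ∀ w, P (w - 1) → s w • f m = f m)
    {x y : F} (hx : x ≠ 0) (hxP : P x) (hyO : O y) (hy : ¬ P y) (hy1 : ¬ P (1 - y)) :
    f y = f x + s (1 - x) • f (1 - y)⁻¹ := by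
  have y0 : y ≠ 0 := fun h => hy (h ▸ C.P0)
  have y1 : 1 - y ≠ 0 := fun h => hy1 (h ▸ C.P0)
  have t0 := C.one_sub hxP
  have h := C.ft' hx y0 t0 y1
  have hT := C.U1m hxP
  have hy1O : O (1 - y) := by
    have := C.Oadd _ _ C.O1 (C.Oneg hyO)
    rwa [← sub_eq_add_neg] at this
  have p1 : P (y⁻¹ * x) := C.OP _ _ (C.notP _ hy) hxP
  have p2 : P ((1 - y) * y⁻¹ * x) := C.OP _ _ (C.Omul _ _ hy1O (C.notP _ hy)) hxP
  have n1 : y⁻¹ * x ≠ 0 := mul_ne_zero (inv_ne_zero y0) hx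
  have n2 : (1 - y) * y⁻¹ * x ≠ 0 := mul_ne_zero (mul_ne_zero y1 (inv_ne_zero y0)) hx
  have e1 : y * x⁻¹ = (y⁻¹ * x)⁻¹ := by field_simp
  rw [C.fcong' (x := ((1 - y) * y⁻¹ * x)⁻¹) (y := (1 - x) / (1 - y) * (y * x⁻¹))
      (u := 1 - x) (inv_ne_zero n2) hT (by field_simp),
    C.fcong' (x := (1 - y)⁻¹) (y := (1 - x) / (1 - y)) (u := 1 - x) (inv_ne_zero y1) hT
      (by field_simp), e1, C.finv n1, C.finv n2, C.lemG1 hU n1 p1 hx hxP,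
      C.lemG1 hU n2 p2 hx hxP, C.lemF1 hU hx hxP] at h
  have u := hU x hx hxP _ hT
  linear_combination (norm := module) -h + s x • u

theorem main (C : VCtx F R Q P O s f) {x u : F} (hx : x ≠ 0) (hu : P (u - 1)) :
    s u • f x = f x := by
  by_cases hu1 : u = 1
  · rw [hu1, map_one, one_smul]
  have hz : 1 - u ≠ 0 := fun h => hu1 (by linear_combination -h)
  have hzP : P (1 - u) := by simpa using C.Pneg hu
  have hU : ∀ m, m ≠ 0 → P m → ∀ w, P (w - 1) → s w • f m = f m := by
    intro m hm hmP w hw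
    by_cases hw1 : w = 1
    · rw [hw1, map_one, one_smul]
    exact C.lemE1 hm hmP hw hw1
  by_cases h1 : P x
  · exact hU x hx h1 u hu
  by_cases h2 : O x
  swap
  · have h3 := hU _ (inv_ne_zero hx) (C.notO _ h2) u hu
    have h4 := C.finv (inv_ne_zero hx)
    rw [inv_inv] at h4
    rw [h4]
    linear_combination (norm := module) (-s (-1)) • h3
  by_cases h3 : P (1 - x)
  · have : P (x - 1) := by simpa using C.Pneg h3
    rw [C.fU _ this, smul_zero]
  have x1 : 1 - x ≠ 0 := fun h => h3 (h ▸ C.P0)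
  have h1xO : O (1 - x) := by
    have := C.Oadd _ _ C.O1 (C.Oneg h2)
    rwa [← sub_eq_add_neg] at this
  have inv_notP : ∀ a, a ≠ 0 → O a → ¬ P a⁻¹ := by
    intro a ha hO hP
    have := C.OP _ _ hO hP
    rw [mul_inv_cancel₀ ha] at this
    exact C.P1 this
  have ey : 1 - (1 - x)⁻¹ = (1 - x⁻¹)⁻¹ := by
    have : x - 1 ≠ 0 := fun h => x1 (by linear_combination -h)
    have e : 1 - x⁻¹ = -(1 - x) * x⁻¹ := by field_simp; ring
    rw [e]
    field_simp
    ring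
  have e : 1 - x⁻¹ = -(1 - x) * x⁻¹ := by field_simp; ring
  have z0 : 1 - x⁻¹ ≠ 0 := by
    rw [e]; exact mul_ne_zero (neg_ne_zero.mpr x1) (inv_ne_zero hx)
  have zO : O (1 - x⁻¹) := by
    rw [e]; exact C.Omul _ _ (C.Oneg h1xO) (C.notP _ h1)
  have zP : ¬ P (1 - x⁻¹) := by
    intro h
    rw [e] at h
    have := C.OP _ _ h2 (C.Pneg h)
    have e' : x * -(-(1 - x) * x⁻¹) = 1 - x := by field_simp
    rw [e'] at this
    exact h3 this
  have k1 := C.lemH hU hz hzP h2 h1 h3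
  have k2 := C.lemH hU hz hzP (y := (1 - x)⁻¹) (C.notP _ h3) (inv_notP _ x1 h1xO)
    (by rw [ey]; exact inv_notP _ z0 zO)
  have k3 := C.lemH hU hz hzP (y := 1 - x⁻¹) zO zP
    (by rw [sub_sub_cancel]; exact inv_notP _ hx h2)
  rw [ey, inv_inv] at k2
  rw [sub_sub_cancel] at k1 k2 k3
  rw [sub_sub_cancel, inv_inv] at k3
  have u0 := hU _ hz hzP u hu
  have u2 := C.s2 u (C.Une hu)
  have t3 := C.lemG2 hU hz hzP
  generalize f (1 - u) = κ at *
  generalize s u = a at *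
  linear_combination (norm := module) -k1 - a • k2 - (a * a) • k3 - t3 - u0 - a • u0 - u0 - (a * u2) • f x

end VCtx

section Instantiate

variable {F : Type} [Field F] {Γ : Type} [AddCommGroup Γ] [LinearOrder Γ] [IsOrderedAddMonoid Γ]

theorem cls_mul' (a b : Fˣ) : cls F (a * b) = cls F a * cls F b := by
  unfold cls
  rw [map_mul, map_mul]

theorem cls_one' : cls F 1 = 1 := by
  unfold cls
  rw [map_one, map_one]

theorem cls_sq' (a : Fˣ) : cls F a * cls F a = 1 := by
  have h : sqc F (a * a) = 1 := by
    refine (QuotientGroup.eq_one_iff _).mpr ⟨a, ?_⟩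
    simp [pow_two]
  rw [← cls_mul']
  unfold cls
  rw [h, map_one]

/-- the symbol extended by zero -/
noncomputable def sExt (F : Type) [Field F] : F →*₀ RF F where
  toFun a := if h : a ≠ 0 then cls F (U F a h) else 0
  map_zero' := by simp
  map_one' := by
    rw [dif_pos one_ne_zero]
    have : U F 1 one_ne_zero = 1 := Units.ext rfl
    rw [this, cls_one']
  map_mul' a b := by
    by_cases ha : a = 0
    · simp [ha]
    by_cases hb : b = 0
    · simp [hb]
    rw [dif_pos ha, dif_pos hb, dif_pos (mul_ne_zero ha hb), ← cls_mul']
    congr 1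
    exact Units.ext rfl

theorem sExt_eq (a : F) (h : a ≠ 0) : sExt F a = cls F (U F a h) := dif_pos h

theorem sExt_unit (a : Fˣ) : sExt F (a : F) = cls F a := by
  rw [sExt_eq _ a.ne_zero]
  congr 1
  exact Units.ext rfl

/-- the generators extended by zero -/
noncomputable def fExt (v : Fˣ → Γ) (a : F) : qRP F ⧸ Kv F Γ v :=
  if h : a ≠ 0 then Submodule.Quotient.mk (qrp F (U F a h)) else 0

theorem fExt_eq (v : Fˣ → Γ) (a : F) (h : a ≠ 0) :
    fExt v a = Submodule.Quotient.mk (qrp F (U F a h)) := dif_pos h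

theorem fExt_unit (v : Fˣ → Γ) (a : Fˣ) :
    fExt v (a : F) = Submodule.Quotient.mk (qrp F a) := by
  rw [fExt_eq _ _ a.ne_zero]
  congr 2
  exact Units.ext rfl

/-- the maximal ideal -/
def PP (v : Fˣ → Γ) (a : F) : Prop := ∀ h : a ≠ 0, 0 < v (U F a h)

/-- the valuation ring -/
def OO (v : Fˣ → Γ) (a : F) : Prop := ∀ h : a ≠ 0, 0 ≤ v (U F a h)

theorem qrp_rel (v : Fˣ → Γ) (w : FreeRP F) (hw : w ∈ ftRels F ∪ psiRels F) :
    (Kv F Γ v).mkQ ((Submodule.span (RF F) (ftRels F ∪ psiRels F)).mkQ w : qRP F) = 0 := by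
  have : (Submodule.span (RF F) (ftRels F ∪ psiRels F)).mkQ w = 0 := by
    rw [Submodule.mkQ_apply, Submodule.Quotient.mk_eq_zero]
    exact Submodule.subset_span hw
  rw [this]
  exact map_zero _

/-- The composite linear map from the free module. -/
noncomputable def toQ (v : Fˣ → Γ) : FreeRP F →ₗ[RF F] (qRP F ⧸ Kv F Γ v) :=
  (Kv F Γ v).mkQ.comp
    ((Submodule.span (RF F) (ftRels F ∪ psiRels F)).mkQ : FreeRP F →ₗ[RF F] qRP F)

theorem toQ_gen (v : Fˣ → Γ) (a : Fˣ) : toQ v (gen F a) = fExt v (a : F) := by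
  rw [fExt_unit]
  rfl

theorem toQ_rel (v : Fˣ → Γ) (w : FreeRP F) (hw : w ∈ ftRels F ∪ psiRels F) :
    toQ v w = 0 := qrp_rel v w hw

theorem val_one (v : Fˣ → Γ) (hv : IsValuation F Γ v) : v 1 = 0 := by
  have := hv.1 1 1
  rw [mul_one] at this
  exact left_eq_add.mp this

theorem val_inv (v : Fˣ → Γ) (hv : IsValuation F Γ v) (a : Fˣ) : v a⁻¹ = - v a := by
  have := hv.1 a a⁻¹
  rw [mul_inv_cancel, val_one v hv] at this
  exact (neg_eq_of_add_eq_zero_right this.symm).symm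

theorem val_neg_one (v : Fˣ → Γ) (hv : IsValuation F Γ v) : v (-1) = 0 := by
  have := hv.1 (-1) (-1)
  rw [neg_mul_neg, mul_one, val_one v hv] at this
  rcases lt_trichotomy (v (-1)) 0 with h | h | h
  · have := add_neg h h
    order
  · exact h
  · have := add_pos h h
    order

theorem val_U_mul (v : Fˣ → Γ) (hv : IsValuation F Γ v) (a b : F) (ha : a ≠ 0) (hb : b ≠ 0)
    (hab : a * b ≠ 0) : v (U F (a * b) hab) = v (U F a ha) + v (U F b hb) := by
  rw [← hv.1]
  congr 1
  exact Units.ext rfl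

theorem theCtx (v : Fˣ → Γ) (hv : IsValuation F Γ v) :
    VCtx F (RF F) (qRP F ⧸ Kv F Γ v) (PP v) (OO v) (sExt F) (fExt v) where
  Padd a b ha hb := by
    intro h
    by_cases a0 : a = 0
    · subst a0; simp only [zero_add] at h ⊢; exact hb h
    by_cases b0 : b = 0
    · subst b0; simp only [add_zero] at h ⊢; exact ha h
    exact lt_of_lt_of_le (lt_min (ha a0) (hb b0)) (hv.2.2 (U F a a0) (U F b b0) h)
  Oadd a b ha hb := by
    intro h
    by_cases a0 : a = 0
    · subst a0; simp only [zero_add] at h ⊢; exact hb h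
    by_cases b0 : b = 0
    · subst b0; simp only [add_zero] at h ⊢; exact ha h
    exact le_trans (le_min (ha a0) (hb b0)) (hv.2.2 (U F a a0) (U F b b0) h)
  Omul a b ha hb := by
    intro h
    have a0 := left_ne_zero_of_mul h
    have b0 := right_ne_zero_of_mul h
    rw [val_U_mul v hv a b a0 b0]
    exact add_nonneg (ha a0) (hb b0)
  OP a b ha hb := by
    intro h
    have a0 := left_ne_zero_of_mul h
    have b0 := right_ne_zero_of_mul h
    rw [val_U_mul v hv a b a0 b0]
    exact add_pos_of_nonneg_of_pos (ha a0) (hb b0)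
  PO a ha := fun h => (ha h).le
  P0 := fun h => absurd rfl h
  O1 := by
    intro h
    have : U F 1 h = 1 := Units.ext rfl
    rw [this, val_one v hv]
  Om1 := by
    intro h
    have : U F (-1) h = -1 := Units.ext rfl
    rw [this, val_neg_one v hv]
  P1 := by
    intro h
    have h1 := h one_ne_zero
    have : U F 1 one_ne_zero = 1 := Units.ext rfl
    rw [this, val_one v hv] at h1
    exact lt_irrefl _ h1
  notP a ha := by
    unfold PP at ha
    push Not at ha
    obtain ⟨h, ha⟩ := ha
    intro h'
    have : U F a⁻¹ h' = (U F a h)⁻¹ := Units.ext (by simp [U])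
    rw [this, val_inv v hv]
    exact neg_nonneg.mpr ha
  notO a ha := by
    unfold OO at ha
    push Not at ha
    obtain ⟨h, ha⟩ := ha
    intro h'
    have : U F a⁻¹ h' = (U F a h)⁻¹ := Units.ext (by simp [U])
    rw [this, val_inv v hv]
    exact neg_pos.mpr ha
  s2 a ha := by
    rw [sExt_eq a ha, cls_sq']
  psi a ha := by
    have h := toQ_rel v (gen F (U F a ha) + cls F (-1) • gen F (U F a ha)⁻¹)
      (Or.inr ⟨_, rfl⟩)
    rw [map_add, map_smul, toQ_gen, toQ_gen, ← sExt_unit] at h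
    simpa [U] using h
  fU a ha := by
    unfold fExt
    split_ifs with h
    · rw [Submodule.Quotient.mk_eq_zero]
      refine Submodule.subset_span ⟨_, ?_, rfl⟩
      by_cases h1 : a = 1
      · left; exact h1
      · right; exact ⟨sub_ne_zero.mpr h1, ha _⟩
    · rfl
  ft x y hx hy hx1 hy1 := by
    have h := toQ_rel v (FT F (U F x hx) (U F y hy) hx1 hy1) (Or.inl ⟨_, _, _, _, rfl⟩)
    unfold FT at h
    rw [map_add, map_sub, map_add, map_sub, map_smul, map_smul, map_smul] at h
    simp only [toQ_gen, ← sExt_unit] at h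
    simpa [U] using h

end Instantiate

/-- Let `F` be a field with at least 4 elements, `v` a valuation on `F`
(with values in a totally ordered abelian group `Γ`), and `(qRP F)_v := qRP(F)/K_v`.
Then `⟨u⟩·[x] = [x]` in `(qRP F)_v` for all `x ∈ F^×` and all `u ∈ 1 + M_v`. -/
theorem statement8 (F : Type) [Field F] (hcard : 4 ≤ Cardinal.mk F)
    (Γ : Type) [AddCommGroup Γ] [LinearOrder Γ] [IsOrderedAddMonoid Γ] (v : Fˣ → Γ) (hv : IsValuation F Γ v)
    (x u : Fˣ) (hu : u ∈ U1Set F Γ v) :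
    (Submodule.Quotient.mk (cls F u • qrp F x) : qRP F ⧸ Kv F Γ v) =
      Submodule.Quotient.mk (qrp F x) := by
  have hP : PP v ((u : F) - 1) := by
    intro h
    rcases hu with hu | ⟨_, hu⟩
    · exact absurd (sub_eq_zero.mpr hu) h
    · exact hu
  have h := (theCtx v hv).main x.ne_zero hP
  rw [sExt_unit, fExt_unit] at h
  rw [Submodule.Quotient.mk_smul]
  exact h
end
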